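/- Let d, m ≥ 1 be integers, p > 1 a real number, and S > 0. Suppose u : Γ_d → ℝ^m \ {0} is smooth and nowhere vanishing, satisfies u(e^S t, e^S x) = e^{−(2/(p−1))S} u(t,x) on Γ_d, satisfies ⟨u, □u⟩ > 0 throughout Γ_d, and satisfies ∂_α⟨u, □u⟩ = (p+1)⟨∂_α u, □u⟩ on Γ_d for each coordinate derivative ∂_α ∈ {∂_t, ∂_{x_1}, …, ∂_{x_d}}; suppose further that the map θ := u/‖u‖ : Γ_d → S^{m−1} satisfies: θ(t,x) = θ(t',x') implies (t',x') = (e^{nS}t, e^{nS}x) for some integer n, and the d+1 vectors ∂_α θ(t,x) are linearly independent in ℝ^m at every point of Γ_d. Then there exists a defocusing potential F : ℝ^m → ℝ, homogeneous of order p+1, such that □u = (∇F)(u) on Γ_d. -/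

import Mathlib

open Real MeasureTheory
open scoped RealInnerProductSpace

noncomputable section

/-- Spacetime `ℝ^{1+d}` realised as `Fin (d+1) → ℝ`; coordinate `0` is the time `t`,
coordinates `i.succ` are the spatial coordinates `x_i`. -/
abbrev Sp (d : ℕ) := Fin (d + 1) → ℝ

/-- The Euclidean target space `ℝ^m`. -/
abbrev Em (m : ℕ) := EuclideanSpace ℝ (Fin m)

/-- The coordinate partial derivative `∂_α`. -/
def pd {d : ℕ} {E : Type*} [NormedAddCommGroup E] [NormedSpace ℝ E]
    (α : Fin (d + 1)) (f : Sp d → E) : Sp d → E :=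
  fun x => fderiv ℝ f x (Pi.single α 1)

/-- The d'Alembertian `□ = -∂_t² + ∑_i ∂_{x_i}²`. -/
def dAlembert {d : ℕ} {E : Type*} [NormedAddCommGroup E] [NormedSpace ℝ E]
    (f : Sp d → E) : Sp d → E :=
  fun x => -(pd 0 (pd 0 f) x) + ∑ i : Fin d, pd i.succ (pd i.succ f) x

/-- The (truncated, solid) light cone `Γ_d = {(t,x) : t > 0, |x| ≤ t}`,
with `|x|` the Euclidean norm. -/
def Cone (d : ℕ) : Set (Sp d) :=
  {y | 0 < y 0 ∧ ∑ i : Fin d, (y i.succ) ^ 2 ≤ (y 0) ^ 2}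

section Gluing

open scoped ContDiff Manifold Topology

/-- Local positive smooth functions with prescribed value and derivative along a family of points
glue to a global one. -/
lemma exists_contDiff_pos_of_local {ι E : Type*} [NormedAddCommGroup E] [NormedSpace ℝ E]
    [FiniteDimensional ℝ E] (s : Set ι) (θ : ι → E) (f : ι → ℝ) (A : ι → E →L[ℝ] ℝ)
    (hloc : ∀ x : E, ∃ U : Set E, IsOpen U ∧ x ∈ U ∧ ∃ g : E → ℝ, ContDiffOn ℝ ∞ g U ∧
      (∀ z ∈ U, 0 < g z) ∧ ∀ y ∈ s, θ y ∈ U → g (θ y) = f y ∧ HasFDerivAt g (A y) (θ y)) :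
    ∃ G : E → ℝ, ContDiff ℝ ∞ G ∧ (∀ z, 0 < G z) ∧
      ∀ y ∈ s, G (θ y) = f y ∧ HasFDerivAt G (A y) (θ y) := by
  choose U hUo hxU g hg hgpos hgA using hloc
  obtain ⟨ρ, hρ⟩ := SmoothPartitionOfUnity.exists_isSubordinate 𝓘(ℝ, E) isClosed_univ U hUo
    (fun x _ => Set.mem_iUnion.2 ⟨x, hxU x⟩)
  have hmem : ∀ i x, ρ i x ≠ 0 → x ∈ U i := fun i x h => hρ i (subset_tsupport _ h)
  refine ⟨fun x => ∑ᶠ i, ρ i x • g i x, ?_, fun z => ?_, fun y hy => ⟨?_, ?_⟩⟩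
  · exact (ρ.contMDiff_finsum_smul (n := ⊤) (g := g) fun i x hx =>
      ((hg i).contDiffAt ((hUo i).mem_nhds (hρ i hx))).contMDiffAt).contDiff
  · exact ρ.finsum_smul_mem_convex (g := g) (t := Set.Ioi 0) (Set.mem_univ z)
      (fun i hi => hgpos i z (hmem i z hi)) (convex_Ioi 0)
  · exact ρ.finsum_smul_mem_convex (g := g) (t := {f y}) (Set.mem_univ _)
      (fun i hi => (hgA i y hy (hmem i _ hi)).1) (convex_singleton _)
  · set I := ρ.fintsupport (θ y)
    have hev := ρ.eventually_finsupport_subset (θ y)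
    have hG : (fun x => ∑ᶠ i, ρ i x • g i x) =ᶠ[𝓝 (θ y)] fun x => ∑ i ∈ I, ρ i x • g i x := by
      filter_upwards [hev] with x hx
      refine finsum_eq_sum_of_support_subset _ fun i hi => hx ?_
      rw [SmoothPartitionOfUnity.mem_finsupport]
      exact fun h => hi (by simp only [h, zero_smul])
    have hone : (fun x => ∑ i ∈ I, ρ i x) =ᶠ[𝓝 (θ y)] fun _ => 1 := by
      filter_upwards [hev] with x hx using ρ.sum_finsupport' x (Set.mem_univ _) hx
    have hd : ∀ i, HasFDerivAt (ρ i) (fderiv ℝ (ρ i) (θ y)) (θ y) := fun i =>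
      ((ρ i).contMDiff.contDiff.differentiable (by simp)).differentiableAt.hasFDerivAt
    have hsum : ∑ i ∈ I, fderiv ℝ (ρ i) (θ y) = 0 :=
      (HasFDerivAt.fun_sum fun i _ => hd i).unique
        ((hasFDerivAt_const (1 : ℝ) (θ y)).congr_of_eventuallyEq hone)
    refine HasFDerivAt.congr_of_eventuallyEq ?_ hG
    have hterm : ∀ i ∈ I, HasFDerivAt (fun x => ρ i x • g i x)
        (ρ i (θ y) • A y + f y • fderiv ℝ (ρ i) (θ y)) (θ y) := fun i hi => by
      obtain ⟨h1, h2⟩ := hgA i y hy (hρ i ((ρ.mem_fintsupport_iff _ i).1 hi))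
      rw [← h1]
      exact (hd i).mul h2
    refine (HasFDerivAt.fun_sum hterm).congr_fderiv ?_
    rw [Finset.sum_add_distrib, ← Finset.sum_smul, ← Finset.smul_sum, hsum, hone.eq_of_nhds]
    simp

/-- Near an immersed point, a function and a covector field along the immersion extend to a
function on the target space, with the given covector field as derivative. -/
lemma exists_local_extension {X E : Type*} [NormedAddCommGroup X] [NormedSpace ℝ X]
    [FiniteDimensional ℝ X] [NormedAddCommGroup E] [NormedSpace ℝ E] [FiniteDimensional ℝ E]
    {W : Set X} (hW : IsOpen W) {θ : X → E} {f : X → ℝ} {A : X → E →L[ℝ] ℝ}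
    (hθ : ContDiffOn ℝ ∞ θ W) (hf : ContDiffOn ℝ ∞ f W) (hA : ContDiffOn ℝ ∞ A W)
    {y₀ : X} (hy₀ : y₀ ∈ W) (hinj : Function.Injective (fderiv ℝ θ y₀)) :
    ∃ V : Set X, IsOpen V ∧ y₀ ∈ V ∧ ∃ U : Set E, IsOpen U ∧ θ y₀ ∈ U ∧ ∃ g : E → ℝ,
      ContDiffOn ℝ ∞ g U ∧ ∀ y ∈ V, θ y ∈ U → g (θ y) = f y ∧
        (fderiv ℝ f y = (A y).comp (fderiv ℝ θ y) → HasFDerivAt g (A y) (θ y)) := by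
  have hθd : ∀ y ∈ W, HasFDerivAt θ (fderiv ℝ θ y) y := fun y hy =>
    ((hθ.contDiffAt (hW.mem_nhds hy)).differentiableAt (by simp)).hasFDerivAt
  obtain ⟨L', hL'⟩ := LinearMap.exists_leftInverse_of_injective (fderiv ℝ θ y₀ : X →ₗ[ℝ] E)
    (LinearMap.ker_eq_bot.2 hinj)
  set L : E →L[ℝ] X := LinearMap.toContinuousLinearMap L'
  have hφ : ContDiffOn ℝ ∞ (L ∘ θ) W := L.contDiff.comp_contDiffOn hθ
  have hφd : ∀ y ∈ W, HasFDerivAt (L ∘ θ) (L.comp (fderiv ℝ θ y)) y := fun y hy =>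
    L.hasFDerivAt.comp y (hθd y hy)
  have hid : L.comp (fderiv ℝ θ y₀) =
      ((ContinuousLinearEquiv.refl ℝ X : X ≃L[ℝ] X) : X →L[ℝ] X) := by
    ext v
    exact LinearMap.congr_fun hL' v
  have hc₀ : ContDiffAt ℝ ∞ (L ∘ θ) y₀ := hφ.contDiffAt (hW.mem_nhds hy₀)
  have hd₀ := hφd y₀ hy₀
  rw [hid] at hd₀
  set e₀ := hc₀.toOpenPartialHomeomorph (L ∘ θ) hd₀ (by simp)
  set R := Set.range ((↑) : (X ≃L[ℝ] X) → X →L[ℝ] X)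
  have hcont : ContinuousOn (fun y => L.comp (fderiv ℝ θ y)) W :=
    continuousOn_const.clm_comp (hθ.continuousOn_fderiv_of_isOpen hW (by simp))
  have hVo := hcont.isOpen_inter_preimage hW
    (ContinuousLinearEquiv.isOpen (𝕜 := ℝ) (E := X) (F := X))
  set V₀ := W ∩ (fun y => L.comp (fderiv ℝ θ y)) ⁻¹' R
  set e := e₀.restrOpen V₀ hVo
  have hey₀ : y₀ ∈ e.source := ⟨hc₀.mem_toOpenPartialHomeomorph_source hd₀ (by simp), hy₀,
    ⟨ContinuousLinearEquiv.refl ℝ X, hid.symm⟩⟩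
  have hsrc : ∀ z ∈ e.target, e.symm z ∈ V₀ := fun z hz => (e.map_target hz).2
  have hsymm : ContDiffOn ℝ ∞ e.symm e.target := fun z hz => by
    obtain ⟨hzW, f', hf'⟩ := hsrc z hz
    refine (e.contDiffAt_symm (f₀' := f') hz ?_ (hφ.contDiffAt (hW.mem_nhds hzW))).contDiffWithinAt
    rw [hf']
    exact hφd _ hzW
  set a : E → X := fun v => e.symm (L v)
  set U : Set E := L ⁻¹' e.target
  have hUo : IsOpen U := e.open_target.preimage L.continuous
  have ha : ContDiffOn ℝ ∞ a U := hsymm.comp L.contDiff.contDiffOn fun v hv => hv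
  have haW : Set.MapsTo a U W := fun v hv => (hsrc _ hv).1
  have haθ : ∀ y ∈ e.source, a (θ y) = y := fun y hy => e.left_inv hy
  refine ⟨e.source, e.open_source, hey₀, U, hUo, e.map_source hey₀,
    fun v => f (a v) + A (a v) (v - θ (a v)), ?_, fun y hy hyU => ⟨?_, fun hfA => ?_⟩⟩
  · exact (hf.comp ha haW).add ((hA.comp ha haW).clm_apply
      (contDiffOn_id.sub (hθ.comp ha haW)))
  · simp [haθ y hy]
  · have hyW : y ∈ W := hy.2.1
    have hya := haθ y hy
    have hda : HasFDerivAt a (fderiv ℝ a (θ y)) (θ y) :=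
      ((ha.contDiffAt (hUo.mem_nhds hyU)).differentiableAt (by simp)).hasFDerivAt
    have hdf : HasFDerivAt f (fderiv ℝ f y) (a (θ y)) := by
      rw [hya]
      exact ((hf.contDiffAt (hW.mem_nhds hyW)).differentiableAt (by simp)).hasFDerivAt
    have hdA : HasFDerivAt A (fderiv ℝ A y) (a (θ y)) := by
      rw [hya]
      exact ((hA.contDiffAt (hW.mem_nhds hyW)).differentiableAt (by simp)).hasFDerivAt
    have hdθ : HasFDerivAt θ (fderiv ℝ θ y) (a (θ y)) := by
      rw [hya]
      exact hθd y hyW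
    have h := (hdf.comp (θ y) hda).add ((hdA.comp (θ y) hda).clm_apply
      ((hasFDerivAt_id (θ y)).sub (hdθ.comp (θ y) hda)))
    refine h.congr_fderiv ?_
    ext w
    simp [hya, hfA]

end Gluing

section Cone

open scoped ContDiff Topology

lemma smul_mem_cone {d : ℕ} {c : ℝ} (hc : 0 < c) {y : Sp d} (hy : y ∈ Cone d) :
    c • y ∈ Cone d := by
  refine ⟨mul_pos hc hy.1, ?_⟩
  simp only [Pi.smul_apply, smul_eq_mul, mul_pow, ← Finset.mul_sum]
  exact mul_le_mul_of_nonneg_left hy.2 (by positivity)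

lemma isOpen_strictCone (d : ℕ) :
    IsOpen {y : Sp d | 0 < y 0 ∧ ∑ i : Fin d, (y i.succ) ^ 2 < (y 0) ^ 2} :=
  (isOpen_lt (f := fun _ : Sp d => (0 : ℝ)) (g := fun y : Sp d => y 0)
    (by fun_prop) (by fun_prop)).inter
  (isOpen_lt (f := fun y : Sp d => ∑ i : Fin d, (y i.succ) ^ 2) (g := fun y : Sp d => (y 0) ^ 2)
    (by fun_prop) (by fun_prop))

lemma cone_subset_closure_strictCone (d : ℕ) :
    Cone d ⊆ closure {y : Sp d | 0 < y 0 ∧ ∑ i : Fin d, (y i.succ) ^ 2 < (y 0) ^ 2} := by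
  intro y hy
  have hlim : Filter.Tendsto (fun ε : ℝ => y + ε • (Pi.single 0 1 : Sp d)) (𝓝[>] 0) (𝓝 y) := by
    have h : Continuous fun ε : ℝ => y + ε • (Pi.single 0 1 : Sp d) := by fun_prop
    simpa using (h.tendsto 0).mono_left nhdsWithin_le_nhds
  refine mem_closure_of_tendsto hlim ?_
  filter_upwards [self_mem_nhdsWithin] with ε hε
  have hε' : 0 < ε := hε
  refine ⟨by simpa using add_pos hy.1 hε', ?_⟩
  have h0 : (y + ε • (Pi.single 0 1 : Sp d)) 0 = y 0 + ε := by simp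
  have h1 : ∀ i : Fin d, (y + ε • (Pi.single 0 1 : Sp d)) i.succ = y i.succ := by simp
  simp only [h0, h1]
  nlinarith [hy.1, hy.2]

lemma isCompact_cone_slab (d : ℕ) {c : ℝ} (hc : 0 < c) (C : ℝ) :
    IsCompact (Cone d ∩ {y | y 0 ∈ Set.Icc c C}) := by
  have heq : Cone d ∩ {y | y 0 ∈ Set.Icc c C} = {y : Sp d | c ≤ y 0} ∩ {y | y 0 ≤ C} ∩
      {y | ∑ i : Fin d, (y i.succ) ^ 2 ≤ (y 0) ^ 2} := by
    ext y
    exact ⟨fun h => ⟨h.2, h.1.2⟩, fun h => ⟨⟨hc.trans_le h.1.1, h.2⟩, h.1⟩⟩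
  have hclosed : IsClosed (Cone d ∩ {y | y 0 ∈ Set.Icc c C}) := by
    rw [heq]
    exact ((isClosed_le (by fun_prop) (by fun_prop)).inter
      (isClosed_le (by fun_prop) (by fun_prop))).inter (isClosed_le (by fun_prop) (by fun_prop))
  refine (isCompact_closedBall (0 : Sp d) C).of_isClosed_subset hclosed fun y hy => ?_
  have hy0 := hy.1.1
  have hyC : y 0 ≤ C := hy.2.2
  rw [mem_closedBall_zero_iff, pi_norm_le_iff_of_nonneg (hy0.le.trans hyC)]
  refine Fin.cases ?_ fun i => ?_
  · rwa [Real.norm_of_nonneg hy0.le]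
  · refine le_trans (abs_le_of_sq_le_sq ?_ hy0.le) hyC
    exact (Finset.single_le_sum (f := fun j : Fin d => (y j.succ) ^ 2)
      (fun j _ => sq_nonneg _) (Finset.mem_univ i)).trans hy.1.2

lemma exists_zsmul_mem_slab {d : ℕ} {S c : ℝ} (hS : 0 < S) (hc : 0 < c) {y : Sp d}
    (hy : y ∈ Cone d) :
    ∃ n : ℤ, Real.exp ((n : ℝ) * S) • y ∈ Cone d ∩ {z | z 0 ∈ Set.Icc c (c * Real.exp S)} := by
  obtain ⟨n, hn, -⟩ := existsUnique_add_zsmul_mem_Ico hS (Real.log (y 0)) (Real.log c)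
  refine ⟨n, smul_mem_cone (Real.exp_pos _) hy, ?_⟩
  have h : (Real.exp ((n : ℝ) * S) • y) 0 = Real.exp (Real.log (y 0) + n • S) := by
    rw [Real.exp_add, Real.exp_log hy.1, zsmul_eq_mul, mul_comm (y 0)]
    rfl
  have h1 : c = Real.exp (Real.log c) := (Real.exp_log hc).symm
  have h2 : c * Real.exp S = Real.exp (Real.log c + S) := by rw [Real.exp_add, Real.exp_log hc]
  refine ⟨?_, ?_⟩
  · rw [h, h1]
    exact Real.exp_le_exp.2 (by simpa using hn.1)
  · rw [h, h2]
    exact Real.exp_le_exp.2 hn.2.le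

lemma apply_exp_int_smul {d : ℕ} {T : Type*} {S : ℝ} {Q : Sp d → T}
    (hQ : ∀ y ∈ Cone d, Q (Real.exp S • y) = Q y) (n : ℤ) {y : Sp d} (hy : y ∈ Cone d) :
    Q (Real.exp ((n : ℝ) * S) • y) = Q y := by
  have hstep : ∀ a : ℝ, Q (Real.exp (a + S) • y) = Q (Real.exp a • y) := fun a => by
    rw [← hQ _ (smul_mem_cone (Real.exp_pos a) hy), smul_smul, ← Real.exp_add, add_comm a]
  induction n using Int.induction_on with
  | zero => simp
  | succ n ih =>
    rw [← ih, ← hstep (((n : ℤ) : ℝ) * S)]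
    push_cast
    rw [add_mul, one_mul]
  | pred n ih =>
    rw [← ih, ← hstep]
    push_cast
    rw [sub_mul, one_mul, sub_add_cancel]

section Orbit

variable {d : ℕ} {E : Type*} [TopologicalSpace E] [T2Space E] {S : ℝ} {θ : Sp d → E}

/-- Directions close to `θ y₀` are only attained near the orbit of `y₀` under the scaling. -/
lemma exists_open_forall_orbit_meets (hS : 0 < S) (hθ : ContinuousOn θ (Cone d))
    (hinv : ∀ y ∈ Cone d, θ (Real.exp S • y) = θ y)
    (hinj : ∀ y ∈ Cone d, ∀ y' ∈ Cone d, θ y = θ y' → ∃ n : ℤ, y' = Real.exp ((n : ℝ) * S) • y)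
    {y₀ : Sp d} (hy₀ : y₀ ∈ Cone d) {V : Set (Sp d)} (hV : IsOpen V) (hyV : y₀ ∈ V) :
    ∃ U : Set E, IsOpen U ∧ θ y₀ ∈ U ∧
      ∀ y ∈ Cone d, θ y ∈ U → ∃ n : ℤ, Real.exp ((n : ℝ) * S) • y ∈ V := by
  set O : Set (Sp d) := ⋃ n : ℤ, (fun y => Real.exp ((n : ℝ) * S) • y) ⁻¹' V
  have hO : IsOpen O := isOpen_iUnion fun n => hV.preimage (continuous_const_smul _)
  set Q := Cone d ∩ {z | z 0 ∈ Set.Icc 1 (1 * Real.exp S)}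
  have hK : IsCompact (θ '' (Q \ O)) :=
    ((isCompact_cone_slab d one_pos _).diff hO).image_of_continuousOn
      (hθ.mono fun y hy => hy.1.1)
  refine ⟨(θ '' (Q \ O))ᶜ, hK.isClosed.isOpen_compl, ?_, fun y hy hyU => ?_⟩
  · rintro ⟨q, ⟨hqQ, hqO⟩, hq⟩
    obtain ⟨n, hn⟩ := hinj q hqQ.1 y₀ hy₀ hq
    exact hqO (Set.mem_iUnion.2 ⟨n, by rwa [Set.mem_preimage, ← hn]⟩)
  · obtain ⟨n, hn⟩ := exists_zsmul_mem_slab hS one_pos hy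
    by_contra! hno
    refine hyU ⟨_, ⟨hn, fun hmem => ?_⟩, apply_exp_int_smul hinv n hy⟩
    obtain ⟨k, hk⟩ := Set.mem_iUnion.1 hmem
    refine hno (k + n) ?_
    rw [Set.mem_preimage, smul_smul, ← Real.exp_add, ← add_mul] at hk
    exact_mod_cast hk

lemma isClosed_image_cone (hS : 0 < S) (hθ : ContinuousOn θ (Cone d))
    (hinv : ∀ y ∈ Cone d, θ (Real.exp S • y) = θ y) : IsClosed (θ '' Cone d) := by
  have heq : θ '' Cone d = θ '' (Cone d ∩ {z | z 0 ∈ Set.Icc 1 (1 * Real.exp S)}) := by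
    refine Set.Subset.antisymm ?_ (Set.image_mono Set.inter_subset_left)
    rintro _ ⟨y, hy, rfl⟩
    obtain ⟨n, hn⟩ := exists_zsmul_mem_slab hS one_pos hy
    exact ⟨_, hn, apply_exp_int_smul hinv n hy⟩
  rw [heq]
  exact ((isCompact_cone_slab d one_pos _).image_of_continuousOn
    (hθ.mono Set.inter_subset_left)).isClosed

end Orbit

end Cone

section Derivatives

open scoped ContDiff Topology

variable {d : ℕ} {E : Type*} [NormedAddCommGroup E] [NormedSpace ℝ E]

lemma contDiffOn_pd {Ω : Set (Sp d)} (hΩ : IsOpen Ω) {f : Sp d → E} (hf : ContDiffOn ℝ ∞ f Ω)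
    (α : Fin (d + 1)) : ContDiffOn ℝ ∞ (pd α f) Ω :=
  (hf.fderiv_of_isOpen hΩ (by simp)).clm_apply contDiffOn_const

lemma contDiffOn_dAlembert {Ω : Set (Sp d)} (hΩ : IsOpen Ω) {f : Sp d → E}
    (hf : ContDiffOn ℝ ∞ f Ω) : ContDiffOn ℝ ∞ (dAlembert f) Ω :=
  (contDiffOn_pd hΩ (contDiffOn_pd hΩ hf 0) 0).neg.add
    (ContDiffOn.sum fun i _ => contDiffOn_pd hΩ (contDiffOn_pd hΩ hf i.succ) i.succ)

lemma Filter.EventuallyEq.pd {f g : Sp d → E} {y : Sp d} (h : f =ᶠ[𝓝 y] g) (α : Fin (d + 1)) :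
    _root_.pd α f =ᶠ[𝓝 y] _root_.pd α g :=
  (h.fderiv (𝕜 := ℝ)).mono fun _ hz => congrArg (fun L => L (Pi.single α 1)) hz

lemma Filter.EventuallyEq.dAlembert_eq {f g : Sp d → E} {y : Sp d} (h : f =ᶠ[𝓝 y] g) :
    dAlembert f y = dAlembert g y := by
  simp only [dAlembert, ((h.pd _).pd _).eq_of_nhds]

lemma pd_smul_comp_smul (k c : ℝ) (f : Sp d → E) (α : Fin (d + 1)) :
    pd α (fun z => k • f (c • z)) = fun z => (k * c) • pd α f (c • z) := by
  ext1 z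
  have h := congrFun (fderiv_const_smul_field (𝕜 := ℝ) (f := fun z => f (c • z)) k) z
  have h2 := fderiv_comp_smul (𝕜 := ℝ) (f := f) (x := z) c
  simp only [pd]
  change fderiv ℝ (k • fun z => f (c • z)) z _ = _
  rw [h, Pi.smul_apply, h2, smul_smul]
  rfl

lemma dAlembert_smul_comp_smul (k c : ℝ) (f : Sp d → E) (y : Sp d) :
    dAlembert (fun z => k • f (c • z)) y = (k * c * c) • dAlembert f (c • y) := by
  simp only [dAlembert, pd_smul_comp_smul, smul_add, smul_neg, Finset.smul_sum]

/-- A scaling relation on the cone passes to the d'Alembertian, up to the boundary. -/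
lemma dAlembert_of_scaling {Ω : Set (Sp d)} (hΩ : IsOpen Ω) (hΩΓ : Cone d ⊆ Ω) {u : Sp d → E}
    (hu : ContDiffOn ℝ ∞ u Ω) {c k : ℝ} (hc : 0 < c)
    (hss : ∀ y ∈ Cone d, u (c • y) = k • u y) {y : Sp d} (hy : y ∈ Cone d) :
    (c * c) • dAlembert u (c • y) = k • dAlembert u y := by
  set C₀ := {y : Sp d | 0 < y 0 ∧ ∑ i : Fin d, (y i.succ) ^ 2 < (y 0) ^ 2}
  have hsub : C₀ ⊆ Cone d := fun z hz => ⟨hz.1, hz.2.le⟩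
  have hint : Set.EqOn (fun y => (c * c) • dAlembert u (c • y)) (fun y => k • dAlembert u y)
      C₀ := fun z hz => by
    have hev : (fun z => (1 : ℝ) • u (c • z)) =ᶠ[𝓝 z] fun z => k • u ((1 : ℝ) • z) := by
      filter_upwards [(isOpen_strictCone d).mem_nhds hz] with w hw
      simpa using hss w (hsub hw)
    have h := hev.dAlembert_eq
    rw [dAlembert_smul_comp_smul, dAlembert_smul_comp_smul] at h
    simpa using h
  have hD := (contDiffOn_dAlembert hΩ hu).continuousOn.mono hΩΓ
  refine hint.of_subset_closure ?_ ?_ hsub (cone_subset_closure_strictCone d) hy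
  · exact continuousOn_const.smul (hD.comp (continuous_const_smul c).continuousOn
      fun z hz => smul_mem_cone hc hz)
  · exact continuousOn_const.smul hD

lemma continuousLinearMap_ext_single {L M : Sp d →L[ℝ] E}
    (h : ∀ α, L (Pi.single α 1) = M (Pi.single α 1)) : L = M := by
  refine ContinuousLinearMap.coe_injective ((Pi.basisFun ℝ (Fin (d + 1))).ext fun α => ?_)
  simpa using h α

lemma injective_fderiv_of_linearIndependent_pd {f : Sp d → E} {y : Sp d}
    (h : LinearIndependent ℝ fun α => pd α f y) : Function.Injective (fderiv ℝ f y) := by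
  rw [injective_iff_map_eq_zero]
  intro x hx
  have hsum : ∑ α, x α • pd α f y = 0 := by
    rw [← hx]
    conv_rhs => rw [pi_eq_sum_univ' x, map_sum]
    simp [pd, map_smul]
  exact funext (Fintype.linearIndependent_iff.1 h x hsum)

end Derivatives

section Homogeneous

open scoped ContDiff Topology

/-- The homogeneous extension of degree `q` of a function on the unit sphere. -/
def homogeneousExtension {E : Type*} [NormedAddCommGroup E] [NormedSpace ℝ E] (q : ℝ)
    (G : E → ℝ) (v : E) : ℝ :=
  ‖v‖ ^ q * G (‖v‖⁻¹ • v)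

variable {E : Type*} [NormedAddCommGroup E] [InnerProductSpace ℝ E]

lemma contDiffOn_homogeneousExtension (q : ℝ) {G : E → ℝ} (hG : ContDiff ℝ ∞ G) :
    ContDiffOn ℝ ∞ (homogeneousExtension q G) {0}ᶜ := fun v hv => by
  have hN : ContDiffAt ℝ ∞ (fun v : E => ‖v‖) v := contDiffAt_norm ℝ hv
  have hv' : ‖v‖ ≠ 0 := norm_ne_zero_iff.2 hv
  exact ((hN.rpow_const_of_ne hv').mul
    (hG.contDiffAt.comp v ((hN.inv hv').smul contDiffAt_id))).contDiffWithinAt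

lemma homogeneousExtension_smul {q : ℝ} (hq : q ≠ 0) (G : E → ℝ) {l : ℝ} (hl : 0 < l) (v : E) :
    homogeneousExtension q G (l • v) = l ^ q * homogeneousExtension q G v := by
  rcases eq_or_ne v 0 with rfl | hv
  · simp [homogeneousExtension, Real.zero_rpow hq]
  · have h : (l * ‖v‖)⁻¹ • l • v = ‖v‖⁻¹ • v := by
      rw [smul_smul]
      congr 1
      field_simp
    rw [homogeneousExtension, norm_smul, Real.norm_of_nonneg hl.le, h,
      Real.mul_rpow hl.le (norm_nonneg v), homogeneousExtension, mul_assoc]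

/-- Euler's relation determines the radial derivative of a homogeneous extension. -/
lemma hasGradientAt_homogeneousExtension [CompleteSpace E] {p : ℝ} {G : E → ℝ} {v B : E}
    (hv : v ≠ 0)
    (hG : HasFDerivAt G (innerSL ℝ (‖v‖ ^ (-p) • B)) (‖v‖⁻¹ • v))
    (hEuler : ⟪v, B⟫ = (p + 1) * (‖v‖ ^ (p + 1) * G (‖v‖⁻¹ • v))) :
    HasGradientAt (homogeneousExtension (p + 1) G) B v := by
  have hr : 0 < ‖v‖ := norm_pos_iff.2 hv
  obtain ⟨N, hN⟩ : ∃ N, HasFDerivAt (fun v : E => ‖v‖) N v :=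
    ⟨_, ((contDiffAt_norm ℝ hv).differentiableAt one_ne_zero).hasFDerivAt⟩
  have hpow : HasFDerivAt (fun v : E => ‖v‖ ^ (p + 1)) (((p + 1) * ‖v‖ ^ p) • N) v := by
    simpa using hN.rpow_const (p := p + 1) (Or.inl hr.ne')
  have hinv : HasFDerivAt (fun v : E => ‖v‖⁻¹) (-(‖v‖ ^ 2)⁻¹ • N) v :=
    (hasDerivAt_inv hr.ne').comp_hasFDerivAt v hN
  have hdir : HasFDerivAt (fun v : E => ‖v‖⁻¹ • v)
      (‖v‖⁻¹ • ContinuousLinearMap.id ℝ E + (-(‖v‖ ^ 2)⁻¹ • N).smulRight v) v :=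
    hinv.smul (hasFDerivAt_id v)
  have h := hpow.mul (hG.comp (f := fun v : E => ‖v‖⁻¹ • v) v hdir)
  rw [hasGradientAt_iff_hasFDerivAt]
  refine h.congr_fderiv ?_
  ext w
  have hB : ⟪B, v⟫ = (p + 1) * (‖v‖ ^ (p + 1) * G (‖v‖⁻¹ • v)) := by rw [real_inner_comm, hEuler]
  have hp1 : ‖v‖ ^ (p + 1) = ‖v‖ ^ p * ‖v‖ := by rw [Real.rpow_add hr, Real.rpow_one]
  have hp0 : ‖v‖ ^ p ≠ 0 := (Real.rpow_pos_of_pos hr p).ne'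
  simp [inner_smul_right, hB, hp1, Real.rpow_neg hr.le]
  field_simp
  ring

/-- If `⟪u, B⟫` has derivative `(p + 1) ⟪Du, B⟫`, then the normalised values
`‖u‖ ^ (-(p + 1)) * ⟪u, B⟫ / (p + 1)` are differentiated by the covectors `‖u‖ ^ (-p) • B`
along the direction map `‖u‖⁻¹ • u`. -/
lemma fderiv_normalized_inner {X : Type*} [NormedAddCommGroup X] [NormedSpace ℝ X] {p : ℝ}
    (hp : p + 1 ≠ 0) {u B : X → E} {y : X} (hu : DifferentiableAt ℝ u y) (hy : u y ≠ 0)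
    (hg : HasFDerivAt (fun z => ⟪u z, B z⟫)
      ((p + 1) • (innerSL ℝ (B y)).comp (fderiv ℝ u y)) y) :
    fderiv ℝ (fun z => (p + 1)⁻¹ * (‖u z‖ ^ (-(p + 1)) * ⟪u z, B z⟫)) y =
      (innerSL ℝ (‖u y‖ ^ (-p) • B y)).comp (fderiv ℝ (fun z => ‖u z‖⁻¹ • u z) y) := by
  have hr : 0 < ‖u y‖ := norm_pos_iff.2 hy
  obtain ⟨N, hN⟩ : ∃ N, HasFDerivAt (fun z => ‖u z‖) N y :=
    ⟨_, (hu.norm ℝ hy).hasFDerivAt⟩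
  have hpow : HasFDerivAt (fun z => ‖u z‖ ^ (-(p + 1)))
      ((-(p + 1) * ‖u y‖ ^ (-(p + 1) - 1)) • N) y :=
    hN.rpow_const (p := -(p + 1)) (Or.inl hr.ne')
  have hinv : HasFDerivAt (fun z => ‖u z‖⁻¹) (-(‖u y‖ ^ 2)⁻¹ • N) y :=
    (hasDerivAt_inv hr.ne').comp_hasFDerivAt y hN
  have hdir : HasFDerivAt (fun z => ‖u z‖⁻¹ • u z)
      (‖u y‖⁻¹ • fderiv ℝ u y + (-(‖u y‖ ^ 2)⁻¹ • N).smulRight (u y)) y :=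
    hinv.smul hu.hasFDerivAt
  rw [((hpow.fun_mul hg).const_mul (p + 1)⁻¹).fderiv, hdir.fderiv]
  ext w
  have h1 : ‖u y‖ ^ (-(p + 1)) = ‖u y‖ ^ (-p) * ‖u y‖⁻¹ := by
    rw [neg_add, Real.rpow_add hr, Real.rpow_neg_one]
  have h2 : ‖u y‖ ^ (-(p + 1) - 1) = ‖u y‖ ^ (-p) * (‖u y‖ ^ 2)⁻¹ := by
    rw [sub_eq_add_neg, Real.rpow_add hr, h1, Real.rpow_neg_one]
    field_simp
  simp only [h1, h2, _root_.smul_apply, _root_.add_apply,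
    ContinuousLinearMap.comp_apply, innerSL_apply_apply, inner_smul_left, inner_smul_right,
    inner_add_right, smul_eq_mul, ContinuousLinearMap.smulRight_apply, real_inner_comm (B y),
    conj_trivial]
  field_simp

end Homogeneous

/-- Section 3: Theorem 3.1 implies Theorem 2.1; eliminating the potential.
If `u : Γ_d → ℝ^m \ {0}` is smooth, nowhere vanishing, discretely self-similar, satisfies
`⟨u,□u⟩ > 0` and `∂_α⟨u,□u⟩ = (p+1)⟨∂_α u,□u⟩`, and its direction map `θ = u/‖u‖` is
injective up to the discrete scaling and immersed, then there is a defocusing potential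
`F`, homogeneous of order `p+1`, with `□u = ∇F(u)` on `Γ_d`. -/
theorem stmt5 (d m : ℕ) (hd : 1 ≤ d) (hm : 1 ≤ m) (p : ℝ) (hp : 1 < p)
    (S : ℝ) (hS : 0 < S)
    (u : Sp d → Em m) (Ω : Set (Sp d)) (hΩ : IsOpen Ω) (hΩΓ : Cone d ⊆ Ω)
    (hu : ContDiffOn ℝ (⊤ : ℕ∞) u Ω)
    (hne : ∀ y ∈ Cone d, u y ≠ 0)
    (hss : ∀ y ∈ Cone d, u (Real.exp S • y) = Real.exp (-(2 / (p - 1)) * S) • u y)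
    (hpos : ∀ y ∈ Cone d, 0 < ⟪u y, dAlembert u y⟫)
    (heqs : ∀ α : Fin (d + 1), ∀ y ∈ Cone d,
      pd α (fun z => ⟪u z, dAlembert u z⟫) y = (p + 1) * ⟪pd α u y, dAlembert u y⟫)
    (hinj : ∀ y ∈ Cone d, ∀ y' ∈ Cone d,
      ‖u y‖⁻¹ • u y = ‖u y'‖⁻¹ • u y' → ∃ n : ℤ, y' = Real.exp ((n : ℝ) * S) • y)
    (himm : ∀ y ∈ Cone d,
      LinearIndependent ℝ (fun α : Fin (d + 1) => pd α (fun z => ‖u z‖⁻¹ • u z) y)) :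
    ∃ F : Em m → ℝ,
      ContDiffOn ℝ (⊤ : ℕ∞) F {0}ᶜ ∧
      (∀ v : Em m, v ≠ 0 → 0 < F v) ∧
      (∀ l : ℝ, 0 < l → ∀ v : Em m, F (l • v) = l ^ (p + 1) * F v) ∧
      (∀ y ∈ Cone d, dAlembert u y = gradient F (u y)) := by
  have hp1 : p + 1 ≠ 0 := by linarith
  set B := dAlembert u with hBdef
  set W := Ω ∩ u ⁻¹' {0}ᶜ
  have hW : IsOpen W := hu.continuousOn.isOpen_inter_preimage hΩ isOpen_compl_singleton
  have hΓW : Cone d ⊆ W := fun y hy => ⟨hΩΓ hy, hne y hy⟩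
  have huW : ContDiffOn ℝ (⊤ : ℕ∞) u W := hu.mono Set.inter_subset_left
  have hBW : ContDiffOn ℝ (⊤ : ℕ∞) B W := (contDiffOn_dAlembert hΩ hu).mono Set.inter_subset_left
  have hrW : ContDiffOn ℝ (⊤ : ℕ∞) (fun z => ‖u z‖) W := huW.norm ℝ fun z hz => hz.2
  have hr0 : ∀ z ∈ W, ‖u z‖ ≠ 0 := fun z hz => norm_ne_zero_iff.2 hz.2
  set θ : Sp d → Em m := fun z => ‖u z‖⁻¹ • u z
  set f : Sp d → ℝ := fun z => (p + 1)⁻¹ * (‖u z‖ ^ (-(p + 1)) * ⟪u z, B z⟫)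
  set A : Sp d → Em m →L[ℝ] ℝ := fun z => innerSL ℝ (‖u z‖ ^ (-p) • B z)
  have hθW : ContDiffOn ℝ (⊤ : ℕ∞) θ W := (hrW.inv hr0).smul huW
  have hinner : ContDiffOn ℝ (⊤ : ℕ∞) (fun z => ⟪u z, B z⟫) W := huW.inner ℝ hBW
  have hfW : ContDiffOn ℝ (⊤ : ℕ∞) f W :=
    contDiffOn_const.mul ((hrW.rpow_const_of_ne hr0).mul hinner)
  have hAW : ContDiffOn ℝ (⊤ : ℕ∞) A W :=
    (innerSL ℝ).contDiff.comp_contDiffOn ((hrW.rpow_const_of_ne hr0).smul hBW)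
  have hfA : ∀ y ∈ Cone d, fderiv ℝ f y = (A y).comp (fderiv ℝ θ y) := fun y hy => by
    have hyW := hW.mem_nhds (hΓW hy)
    refine fderiv_normalized_inner hp1 ((huW.contDiffAt hyW).differentiableAt (by simp))
      (hne y hy) ?_
    refine ((hinner.contDiffAt hyW).differentiableAt (by simp)).hasFDerivAt.congr_fderiv ?_
    refine continuousLinearMap_ext_single fun α => (heqs α y hy).trans ?_
    simp [pd, real_inner_comm]
  have hinv : ∀ y ∈ Cone d,
      (fun z => (θ z, f z, A z)) (Real.exp S • y) = (fun z => (θ z, f z, A z)) y := fun y hy => by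
    have hr : 0 < ‖u y‖ := norm_pos_iff.2 (hne y hy)
    have hk := Real.exp_pos (-(2 / (p - 1)) * S)
    have hB := dAlembert_of_scaling hΩ hΩΓ hu (Real.exp_pos S) hss hy
    have hθ' : θ (Real.exp S • y) = θ y := by
      simp only [θ, hss y hy, norm_smul, Real.norm_of_nonneg hk.le, smul_smul]
      congr 1
      field_simp
    have hA' : A (Real.exp S • y) = A y := by
      have hBs : B (Real.exp S • y) =
          (Real.exp (-(2 / (p - 1)) * S) * Real.exp (-(2 * S))) • B y := by
        rw [mul_comm, mul_smul, ← hB, smul_smul, ← Real.exp_add, ← Real.exp_add]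
        ring_nf
        simp [hBdef]
      simp only [A, hss y hy, hBs, norm_smul, Real.norm_of_nonneg hk.le, smul_smul]
      rw [Real.mul_rpow hk.le hr.le, ← Real.exp_mul]
      congr 2
      rw [mul_comm (Real.exp _) (‖u y‖ ^ (-p)), mul_assoc, ← Real.exp_add, ← Real.exp_add]
      have hp1' : p - 1 ≠ 0 := by linarith
      have hzero : -(2 / (p - 1)) * S * -p + (-(2 / (p - 1)) * S + -(2 * S)) = 0 := by
        field_simp
        ring
      rw [hzero, Real.exp_zero, mul_one]
    have hf : ∀ z, z ∈ Cone d → f z = (p + 1)⁻¹ * A z (θ z) := fun z hz => by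
      have hz : 0 < ‖u z‖ := norm_pos_iff.2 (hne z hz)
      simp only [f, A, θ, innerSL_apply_apply, inner_smul_left, inner_smul_right,
        real_inner_comm (B z), conj_trivial, neg_add, Real.rpow_add hz, Real.rpow_neg_one]
      ring
    simp only [hf y hy, hf _ (smul_mem_cone (Real.exp_pos S) hy), hθ', hA']
  have hinvθ : ∀ y ∈ Cone d, θ (Real.exp S • y) = θ y := fun y hy => congrArg Prod.fst (hinv y hy)
  have hθc : ContinuousOn θ (Cone d) := hθW.continuousOn.mono hΓW
  have hfpos : ∀ y ∈ Cone d, 0 < f y := fun y hy => by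
    have hr : 0 < ‖u y‖ := norm_pos_iff.2 (hne y hy)
    have := hpos y hy
    have : 0 < p + 1 := by linarith
    positivity
  obtain ⟨G, hG, hGpos, hGA⟩ := exists_contDiff_pos_of_local (Cone d) θ f A fun x => by
    by_cases hx : x ∈ θ '' Cone d
    · obtain ⟨y₀, hy₀, rfl⟩ := hx
      obtain ⟨V, hV, hyV, U, hU, hyU, g, hg, hgA⟩ := exists_local_extension hW hθW hfW hAW
        (hΓW hy₀) (injective_fderiv_of_linearIndependent_pd (himm y₀ hy₀))
      obtain ⟨U', hU', hyU', hmeet⟩ :=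
        exists_open_forall_orbit_meets hS hθc hinvθ hinj hy₀ hV hyV
      refine ⟨U ∩ g ⁻¹' Set.Ioi 0 ∩ U', (hg.continuousOn.isOpen_inter_preimage hU isOpen_Ioi).inter
        hU', ⟨⟨hyU, ?_⟩, hyU'⟩, g, hg.mono fun z hz => hz.1.1, fun z hz => hz.1.2,
        fun y hy hyU => ?_⟩
      · rw [Set.mem_preimage, (hgA y₀ hyV hyU).1]
        exact hfpos y₀ hy₀
      · obtain ⟨n, hn⟩ := hmeet y hy hyU.2
        have hy' := smul_mem_cone (Real.exp_pos ((n : ℝ) * S)) hy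
        have heq := apply_exp_int_smul (Q := fun z => (θ z, f z, A z)) hinv n hy
        simp only [Prod.mk.injEq] at heq
        obtain ⟨h1, h2, h3⟩ := heq
        have h := hgA _ hn (by rw [h1]; exact hyU.1.1)
        rw [← h1, ← h2, ← h3]
        exact ⟨h.1, h.2 (hfA _ hy')⟩
    · exact ⟨(θ '' Cone d)ᶜ, (isClosed_image_cone hS hθc hinvθ).isOpen_compl, hx, fun _ => 1,
        contDiffOn_const, fun _ _ => one_pos, fun y hy hyU => (hyU ⟨y, hy, rfl⟩).elim⟩
  refine ⟨homogeneousExtension (p + 1) G, contDiffOn_homogeneousExtension _ hG, fun v hv => ?_,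
    fun l hl v => homogeneousExtension_smul hp1 G hl v, fun y hy => ?_⟩
  · exact mul_pos (Real.rpow_pos_of_pos (norm_pos_iff.2 hv) _) (hGpos _)
  · obtain ⟨h1, h2⟩ := hGA y hy
    refine (hasGradientAt_homogeneousExtension (hne y hy) h2 ?_).gradient.symm
    have hr : 0 < ‖u y‖ := norm_pos_iff.2 (hne y hy)
    have hG' : G (‖u y‖⁻¹ • u y) = f y := h1
    have hr' : ‖u y‖ ^ (p + 1) ≠ 0 := (Real.rpow_pos_of_pos hr _).ne'
    simp only [hG', f, Real.rpow_neg hr.le]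
    field_simp
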